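/- Let a, b, c, μ ∈ ℂ with Re(c-a) > Re μ > 0, and assume c is not a nonpositive integer. Then for every real x ∈ (-∞,0) ∪ (0,1), one has ∫_I |y|^{c-a-μ-1} (1-y)^{a+b-c} F(a,b;c;y) · |x-y|^{μ-1}/Γ(μ) dy = (Γ(c-a-μ)/Γ(c-a)) · |x|^{c-a-1} (1-x)^{a+b-c+μ} · F(a+μ,b;c;x), where I is the open interval with endpoints 0 and x (fractional integral transformation of type a+). -/

import Mathlib

open MeasureTheory Set Complex Filter

/-- Pochhammer symbol `(a)_k = a (a+1) ⋯ (a+k-1)`. -/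
noncomputable def poch (a : ℂ) (k : ℕ) : ℂ := ∏ i ∈ Finset.range k, (a + i)

/-- The Gauss hypergeometric function `F(a,b;c;x)` for real `x < 1`, defined by the
power series on `[0,1)` and by the (agreeing) Pfaff series for `x < 0`. -/
noncomputable def hypF (a b c : ℂ) (x : ℝ) : ℂ :=
  if 0 ≤ x then
    ∑' k : ℕ, poch a k * poch b k / (poch c k * (Nat.factorial k : ℂ)) * (x : ℂ) ^ k
  else
    ((1 - x : ℝ) : ℂ) ^ (-a) *
      ∑' k : ℕ, poch a k * poch (c - b) k / (poch c k * (Nat.factorial k : ℂ)) *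
        (((x / (x - 1) : ℝ)) : ℂ) ^ k


lemma poch_zero' (a : ℂ) : poch a 0 = 1 := by simp [poch]

lemma poch_succ' (a : ℂ) (k : ℕ) : poch a (k + 1) = poch a k * (a + k) := by
  simp [poch, Finset.prod_range_succ]

/-- Coefficients of the hypergeometric series. -/
noncomputable def hcoef (a b c : ℂ) (k : ℕ) : ℂ :=
  poch a k * poch b k / (poch c k * (Nat.factorial k : ℂ))

lemma poch_ne_zero' {c : ℂ} (hc : ∀ n : ℕ, c ≠ -(n : ℂ)) (k : ℕ) : poch c k ≠ 0 := by
  rw [poch, Finset.prod_ne_zero_iff]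
  intro i _ h
  exact hc i (eq_neg_of_add_eq_zero_left h)

lemma hcoef_zero (a b c : ℂ) : hcoef a b c 0 = 1 := by simp [hcoef, poch]

lemma hcoef_succ (a b : ℂ) {c : ℂ} (hc : ∀ n : ℕ, c ≠ -(n : ℂ)) (k : ℕ) :
    hcoef a b c (k + 1) * ((k + 1) * (c + k)) = hcoef a b c k * ((a + k) * (b + k)) := by
  have h1 := poch_ne_zero' hc k
  have h2 : c + k ≠ 0 := fun h => hc k (eq_neg_of_add_eq_zero_left h)
  have h3 : ((Nat.factorial k : ℕ) : ℂ) ≠ 0 := by exact_mod_cast Nat.factorial_ne_zero k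
  have h4 : ((k : ℂ) + 1) ≠ 0 := by exact_mod_cast Nat.succ_ne_zero k
  simp only [hcoef, poch_succ', Nat.factorial_succ]
  push_cast
  field_simp

lemma tendsto_add_div (a c : ℂ) :
    Tendsto (fun k : ℕ => (a + k) / (c + k)) atTop (nhds 1) := by
  have h0 : Tendsto (fun k : ℕ => (1 : ℂ) / (k : ℂ)) atTop (nhds 0) :=
    tendsto_one_div_atTop_nhds_zero_nat
  have h1 : Tendsto (fun k : ℕ => (a * (1 / (k : ℂ)) + 1) / (c * (1 / (k : ℂ)) + 1)) atTop
      (nhds ((a * 0 + 1) / (c * 0 + 1))) := by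
    apply Tendsto.div
    · exact (h0.const_mul a).add_const 1
    · exact (h0.const_mul c).add_const 1
    · simp
  simp only [mul_zero, zero_add, div_one] at h1
  refine h1.congr' ?_
  filter_upwards [eventually_gt_atTop 0] with k hk
  have : (k : ℂ) ≠ 0 := by exact_mod_cast hk.ne'
  field_simp

lemma hcoef_summable (a b : ℂ) {c : ℂ} (hc : ∀ n : ℕ, c ≠ -(n : ℂ)) {x : ℝ} (hx0 : 0 ≤ x)
    (hx1 : x < 1) : Summable fun k => ‖hcoef a b c k * (x : ℂ) ^ k‖ := by
  obtain ⟨r, hr, hr1⟩ := exists_between hx1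
  apply summable_of_ratio_norm_eventually_le hr1
  have ht : Tendsto (fun k : ℕ => ‖(a + k) / (c + k) * ((b + k) / (1 + k)) * x‖) atTop
      (nhds x) := by
    have := (((tendsto_add_div a c).mul (tendsto_add_div b 1)).mul_const (x : ℂ)).norm
    simpa [abs_of_nonneg hx0] using this
  filter_upwards [ht.eventually (gt_mem_nhds hr)] with k hk
  have h2 : c + k ≠ 0 := fun h => hc k (eq_neg_of_add_eq_zero_left h)
  have h4 : (1 + (k : ℂ)) ≠ 0 := by rw [add_comm]; exact_mod_cast Nat.succ_ne_zero k
  have e : hcoef a b c (k + 1) * (x : ℂ) ^ (k + 1)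
      = ((a + k) / (c + k) * ((b + k) / (1 + k)) * x) * (hcoef a b c k * (x : ℂ) ^ k) := by
    have := hcoef_succ a b hc k
    field_simp
    linear_combination x ^ (k+1) * this
  rw [norm_norm, norm_norm, e, norm_mul]
  exact mul_le_mul_of_nonneg_right hk.le (norm_nonneg _)

open PowerSeries in
lemma coeff_theta (f : ℂ⟦X⟧) (n : ℕ) :
    coeff n (X * derivative ℂ f) = n * coeff n f := by
  cases n with
  | zero => simp
  | succ n => rw [coeff_succ_X_mul, coeff_derivative]; push_cast; ring

open PowerSeries in
/-- The hypergeometric differential operator on power series. -/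
noncomputable def hop (a b c : ℂ) (h : ℂ⟦X⟧) : ℂ⟦X⟧ :=
  derivative ℂ (X * derivative ℂ h) + C (c - 1) * derivative ℂ h
    - X * derivative ℂ (X * derivative ℂ h) - C (a + b) * (X * derivative ℂ h) - C (a * b) * h

open PowerSeries in
lemma coeff_hop (a b c : ℂ) (h : ℂ⟦X⟧) (n : ℕ) :
    coeff n (hop a b c h) = coeff (n + 1) h * ((n + 1) * (c + n))
      - coeff n h * ((a + n) * (b + n)) := by
  simp only [hop, map_add, map_sub, coeff_theta, coeff_C_mul, coeff_derivative]
  push_cast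
  simp only [coeff_theta, coeff_C_mul, coeff_derivative, ← map_sub, ← map_add, ← map_mul]
  push_cast
  try ring

open PowerSeries in
lemma euler_formal (a b : ℂ) {c : ℂ} (hc : ∀ n : ℕ, c ≠ -(n : ℂ)) :
    (PowerSeries.mk (fun k => poch (-(c - a - b)) k / (Nat.factorial k : ℂ))) *
      PowerSeries.mk (hcoef (c - a) (c - b) c) = PowerSeries.mk (hcoef a b c) := by
  set P : ℂ⟦X⟧ := PowerSeries.mk (fun k => poch (-(c - a - b)) k / (Nat.factorial k : ℂ)) with hP
  set g : ℂ⟦X⟧ := PowerSeries.mk (hcoef (c - a) (c - b) c) with hg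
  have hg0 : hop (c - a) (c - b) c g = 0 := by
    ext n
    rw [coeff_hop]
    simp only [hg, coeff_mk, hcoef_succ _ _ hc]
    simp
  have hP1 : derivative ℂ P - X * derivative ℂ P = - (C (c - a - b) * P) := by
    ext n
    have h3 : ((Nat.factorial n : ℕ) : ℂ) ≠ 0 := by exact_mod_cast Nat.factorial_ne_zero n
    have h4 : ((n : ℂ) + 1) ≠ 0 := by exact_mod_cast Nat.succ_ne_zero n
    rw [map_sub, map_neg, coeff_theta, coeff_C_mul, coeff_derivative]
    simp only [hP, coeff_mk, poch_succ', Nat.factorial_succ]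
    push_cast
    field_simp
    ring
  have hP2 := congrArg (derivative ℂ) hP1
  have dC : ∀ z : ℂ, derivative ℂ (C z : ℂ⟦X⟧) = 0 := fun z => derivative_C
  simp only [map_sub, map_neg, Derivation.leibniz, smul_eq_mul, derivative_X, dC] at hP2
  have key : hop a b c (P * g) = 0 := by
    have hne : (1 - X : ℂ⟦X⟧) ≠ 0 := by
      intro h
      have := congrArg (coeff 0) h
      simp at this
    apply mul_left_cancel₀ hne
    rw [mul_zero]
    simp only [hop, map_sub, map_add, map_mul, Derivation.leibniz, smul_eq_mul, derivative_X, dC]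
      at hg0 hP1 hP2 ⊢
    set P1 := derivative ℂ P
    set P2 := derivative ℂ P1
    set g1 := derivative ℂ g
    set g2 := derivative ℂ g1
    simp only [map_one] at *
    linear_combination (1 - X) * P * hg0 + X * (1 - X) * g * hP2
      + (X * (1 - (C c - C a - C b)) * g + 2 * X * (1 - X) * g1
        + (C c - (C a + C b + 1) * X) * g) * hP1
  ext n
  rw [coeff_mk]
  induction n with
  | zero => rw [coeff_mul]; simp [hP, hg, hcoef, poch]
  | succ n ih =>
    have := congrArg (coeff n) key
    rw [coeff_hop, map_zero, ih, ← hcoef_succ a b hc, ← sub_mul] at this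
    have h2 : c + n ≠ 0 := fun h => hc n (eq_neg_of_add_eq_zero_left h)
    have h4 : ((n : ℂ) + 1) ≠ 0 := by exact_mod_cast Nat.succ_ne_zero n
    rcases mul_eq_zero.mp this with h | h
    · exact sub_eq_zero.mp h
    · exact absurd h (mul_ne_zero h4 h2)

lemma smeval_asc (s : ℂ) (k : ℕ) :
    (Polynomial.smeval (ascPochhammer ℕ k) s : ℂ) = poch s k := by
  rw [Polynomial.ascPochhammer_smeval_eq_eval]
  induction k with
  | zero => simp [poch]
  | succ k ih => rw [ascPochhammer_succ_eval, ih, poch_succ']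

lemma euler_transf (a b : ℂ) {c : ℂ} (hc : ∀ n : ℕ, c ≠ -(n : ℂ)) {x : ℝ} (hx0 : 0 ≤ x)
    (hx1 : x < 1) :
    ∑' k, hcoef a b c k * (x : ℂ) ^ k = ((1 - x : ℝ) : ℂ) ^ (c - a - b) *
      ∑' k, hcoef (c - a) (c - b) c k * (x : ℂ) ^ k := by
  set s := c - a - b with hs
  have hone : ∀ n : ℕ, (1 : ℂ) ≠ -(n : ℂ) := by
    intro n h
    have : ((n : ℂ) + 1) = 0 := by rw [h]; ring
    exact Nat.cast_add_one_ne_zero n this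
  have hcf : ∀ k, hcoef (-s) 1 1 k = poch (-s) k / (Nat.factorial k : ℂ) := by
    intro k
    have := poch_ne_zero' hone k
    rw [hcoef]
    field_simp
  have hsumP := hcoef_summable (-s) 1 hone hx0 hx1
  simp only [hcf] at hsumP
  have hP : ((1 - x : ℝ) : ℂ) ^ s
      = ∑' k, poch (-s) k / (Nat.factorial k : ℂ) * (x : ℂ) ^ k := by
    have h := (one_div_one_sub_cpow_hasFPowerSeriesOnBall_zero (-s)).hasSum
      (y := (x : ℂ)) (by simp [← ofReal_norm, abs_of_nonneg hx0, hx1])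
    have h2 := h.tsum_eq
    rw [zero_add, cpow_neg, one_div, inv_inv] at h2
    push_cast
    rw [← h2]
    apply tsum_congr
    intro k
    have h3 : ((Nat.factorial k : ℕ) : ℂ) ≠ 0 := by exact_mod_cast Nat.factorial_ne_zero k
    have h5 := Ring.factorial_nsmul_multichoose_eq_ascPochhammer (-s) k
    have h6 := smeval_asc (-s) k
    rw [h6, nsmul_eq_mul] at h5
    rw [← h5, Ring.multichoose_eq]
    simp [FormalMultilinearSeries.ofScalars_apply_eq]
    field_simp
  rw [hP, tsum_mul_tsum_eq_tsum_sum_antidiagonal_of_summable_norm hsumP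
    (hcoef_summable (c - a) (c - b) hc hx0 hx1)]
  apply tsum_congr
  intro n
  have := congrArg (PowerSeries.coeff n) (euler_formal a b hc)
  rw [PowerSeries.coeff_mul] at this
  simp only [PowerSeries.coeff_mk] at this
  rw [← this, Finset.sum_mul]
  apply Finset.sum_congr rfl
  intro p hp
  rw [← Finset.HasAntidiagonal.mem_antidiagonal.mp hp, pow_add]
  ring

lemma Gamma_add_nat {s : ℂ} (hs : 0 < s.re) (k : ℕ) :
    Gamma (s + k) = poch s k * Gamma s := by
  induction k with
  | zero => simp [poch]
  | succ k ih =>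
    have : s + k ≠ 0 := by
      intro h
      have := congrArg Complex.re h
      simp at this
      have hk : (0 : ℝ) ≤ k := Nat.cast_nonneg k
      linarith
    push_cast
    rw [← add_assoc, Gamma_add_one _ this, ih, poch_succ']
    ring

lemma beta_integrable {u v : ℂ} (hu : 0 < u.re) (hv : 0 < v.re) {x : ℝ} (hx : 0 < x) :
    IntegrableOn (fun y : ℝ => (y : ℂ) ^ (u - 1) * ((x : ℂ) - y) ^ (v - 1)) (Ioo 0 x) := by
  have h := (betaIntegral_convergent hu hv).comp_mul_left (c := x⁻¹)
  have h2 : IntervalIntegrable (fun y : ℝ => (y : ℂ) ^ (u - 1) * ((x : ℂ) - y) ^ (v - 1))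
      volume 0 x := by
    have h3 := h.const_mul ((x : ℂ) ^ (u - 1) * (x : ℂ) ^ (v - 1))
    simp only [zero_div, one_div, inv_inv] at h3
    refine h3.congr ?_
    intro y hy
    rw [uIoc_of_le hx.le] at hy
    have e1 : (y : ℂ) ^ (u - 1) = (x : ℂ) ^ (u - 1) * ((x⁻¹ * y : ℝ) : ℂ) ^ (u - 1) := by
      rw [← mul_cpow_ofReal_nonneg hx.le (mul_nonneg (inv_nonneg.2 hx.le) hy.1.le),
        ← ofReal_mul]
      congr 2
      field_simp
    have e2 : ((x : ℂ) - y) ^ (v - 1)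
        = (x : ℂ) ^ (v - 1) * (1 - ((x⁻¹ * y : ℝ) : ℂ)) ^ (v - 1) := by
      have : 0 ≤ 1 - x⁻¹ * y := by
        rw [sub_nonneg, inv_mul_le_iff₀ hx]; linarith [hy.2]
      rw [← ofReal_one, ← ofReal_sub, ← ofReal_sub, ← mul_cpow_ofReal_nonneg hx.le this,
        ← ofReal_mul]
      congr 2
      field_simp
    simp only
    rw [e1, e2]
    ring
  exact ((intervalIntegrable_iff_integrableOn_Ioo_of_le hx.le).1 h2)

lemma core_integral (A B : ℂ) {c μ : ℂ} (hA : μ.re < A.re) (hμ : 0 < μ.re)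
    (hc : ∀ n : ℕ, c ≠ -(n : ℂ)) {x : ℝ} (hx0 : 0 < x) (hx1 : x < 1) :
    ∫ y in Ioo 0 x, (y : ℂ) ^ (A - μ - 1) * (∑' k, hcoef A B c k * (y : ℂ) ^ k) *
      (((x - y : ℝ) : ℂ) ^ (μ - 1) / Gamma μ)
    = Gamma (A - μ) / Gamma A * (x : ℂ) ^ (A - 1) *
      ∑' k, hcoef (A - μ) B c k * (x : ℂ) ^ k := by
  have hAμ : 0 < (A - μ).re := by simp; linarith
  have hA0 : 0 < A.re := by linarith
  have hGμ : Gamma μ ≠ 0 := Gamma_ne_zero_of_re_pos hμ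
  have hGA : Gamma A ≠ 0 := Gamma_ne_zero_of_re_pos hA0
  have hxC : (x : ℂ) ≠ 0 := ofReal_ne_zero.2 hx0.ne'
  have hre : ∀ k : ℕ, 0 < (A - μ + k).re := by
    intro k
    have hk : (0 : ℝ) ≤ k := Nat.cast_nonneg k
    rw [add_re, natCast_re]; linarith
  let G : ℕ → ℝ → ℂ := fun k y => (hcoef A B c k / Gamma μ) *
    ((y : ℂ) ^ ((A - μ + k) - 1) * ((x : ℂ) - y) ^ (μ - 1))
  have hint : ∀ k, Integrable (G k) (volume.restrict (Ioo 0 x)) := fun k =>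
    (beta_integrable (hre k) hμ hx0).const_mul _
  have hG : ∀ k, ∀ y ∈ Ioo 0 x, G k y = (y : ℂ) ^ (A - μ - 1) * (hcoef A B c k * (y : ℂ) ^ k) *
      (((x - y : ℝ) : ℂ) ^ (μ - 1) / Gamma μ) := by
    intro k y hy
    have hy0 : (y : ℂ) ≠ 0 := ofReal_ne_zero.2 hy.1.ne'
    simp only [G]
    rw [show A - μ + k - 1 = (A - μ - 1) + k by ring, cpow_add _ _ hy0, cpow_natCast]
    push_cast
    ring
  have hGi : ∀ k, ∫ y in Ioo 0 x, G k y = Gamma (A - μ) / Gamma A * (x : ℂ) ^ (A - 1) *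
      (hcoef (A - μ) B c k * (x : ℂ) ^ k) := by
    intro k
    have hA0k : poch A k ≠ 0 := by
      apply poch_ne_zero'
      intro n h
      rw [h] at hA0
      simp at hA0
      exact absurd hA0 (not_lt.2 (Nat.cast_nonneg n))
    simp only [G]
    rw [integral_const_mul, ← integral_Ioc_eq_integral_Ioo,
      ← intervalIntegral.integral_of_le hx0.le, betaIntegral_scaled _ _ hx0]
    have hb := Gamma_mul_Gamma_eq_betaIntegral (hre k) hμ
    rw [show A - μ + k + μ = A + k by ring, Gamma_add_nat hAμ, Gamma_add_nat hA0] at hb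
    rw [show A - μ + k + μ - 1 = (A - 1) + k by ring, cpow_add _ _ hxC, cpow_natCast]
    have hb2 : betaIntegral (A - μ + k) μ
        = poch (A - μ) k * Gamma (A - μ) * Gamma μ / (poch A k * Gamma A) := by
      rw [hb]; field_simp
    rw [hb2, hcoef, hcoef]
    have h1 := poch_ne_zero' hc k
    have h3 : ((Nat.factorial k : ℕ) : ℂ) ≠ 0 := by exact_mod_cast Nat.factorial_ne_zero k
    field_simp
  have hsum : Summable fun k => ∫ y in Ioo 0 x, ‖G k y‖ := by
    let g0 : ℝ → ℂ := fun y => (y : ℂ) ^ ((A - μ) - 1) * ((x : ℂ) - y) ^ (μ - 1)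
    have hg0 : Integrable g0 (volume.restrict (Ioo 0 x)) := beta_integrable hAμ hμ hx0
    refine Summable.of_nonneg_of_le (fun k => integral_nonneg fun y => norm_nonneg _)
      (f := fun k => ‖hcoef A B c k * (x : ℂ) ^ k‖ * (∫ y in Ioo 0 x, ‖g0 y‖ / ‖Gamma μ‖)) ?_
      ((hcoef_summable A B hc hx0.le hx1).mul_right _)
    intro k
    rw [← integral_const_mul]
    apply setIntegral_mono_on (hint k).norm ((hg0.norm.div_const _).const_mul _)
      measurableSet_Ioo
    intro y hy
    rw [hG k y hy]
    simp only [g0, norm_mul, norm_div, norm_pow, norm_real, Real.norm_eq_abs,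
      abs_of_pos hx0, abs_of_pos hy.1]
    have hp : y ^ k ≤ x ^ k := pow_le_pow_left₀ hy.1.le hy.2.le k
    rw [← ofReal_sub]
    calc _ = (‖hcoef A B c k‖ * (‖(y : ℂ) ^ (A - μ - 1)‖ * ‖((x - y : ℝ) : ℂ) ^ (μ - 1)‖
          / ‖Gamma μ‖)) * y ^ k := by ring
      _ ≤ (‖hcoef A B c k‖ * (‖(y : ℂ) ^ (A - μ - 1)‖ * ‖((x - y : ℝ) : ℂ) ^ (μ - 1)‖
          / ‖Gamma μ‖)) * x ^ k := by gcongr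
      _ = _ := by ring
  have hfin := hasSum_integral_of_summable_integral_norm hint hsum
  have e : ∫ y in Ioo 0 x, (y : ℂ) ^ (A - μ - 1) * (∑' k, hcoef A B c k * (y : ℂ) ^ k) *
      (((x - y : ℝ) : ℂ) ^ (μ - 1) / Gamma μ) = ∫ y in Ioo 0 x, ∑' k, G k y := by
    apply setIntegral_congr_fun measurableSet_Ioo
    intro y hy
    simp only
    rw [← tsum_mul_left, ← tsum_mul_right]
    exact tsum_congr fun k => (hG k y hy).symm
  rw [e, ← hfin.tsum_eq, ← tsum_mul_left]
  exact tsum_congr hGi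

lemma cpow_pos_eq {t : ℝ} (ht : 0 < t) (s : ℂ) :
    (t : ℂ) ^ s = exp (s * (Real.log t : ℂ)) := by
  rw [cpow_def_of_ne_zero (ofReal_ne_zero.2 ht.ne'), ofReal_log ht.le, mul_comm]

lemma hypF_of_nonneg (a b c : ℂ) {x : ℝ} (hx : 0 ≤ x) :
    hypF a b c x = ∑' k, hcoef a b c k * (x : ℂ) ^ k := by
  rw [hypF, if_pos hx]; rfl

lemma hypF_of_neg (a b c : ℂ) {x : ℝ} (hx : x < 0) :
    hypF a b c x = ((1 - x : ℝ) : ℂ) ^ (-a) *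
      ∑' k, hcoef a (c - b) c k * ((x / (x - 1) : ℝ) : ℂ) ^ k := by
  rw [hypF, if_neg (not_le.2 hx)]; rfl

lemma image_mobius {x : ℝ} (hx : x < 0) :
    (fun z : ℝ => z / (z - 1)) '' Ioo 0 (x / (x - 1)) = Ioo x 0 := by
  have hw : x / (x - 1) < 1 := by
    rw [div_lt_one_of_neg (by linarith)]; linarith
  ext y
  simp only [mem_image, mem_Ioo]
  constructor
  · rintro ⟨z, ⟨h0, h1⟩, rfl⟩
    have hz : z - 1 < 0 := by linarith
    rw [lt_div_iff_of_neg (by linarith)] at h1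
    refine ⟨?_, div_neg_of_pos_of_neg h0 hz⟩
    rw [lt_div_iff_of_neg hz]
    linarith
  · rintro ⟨h0, h1⟩
    have hy : y - 1 < 0 := by linarith
    refine ⟨y / (y - 1), ⟨div_pos_of_neg_of_neg h1 hy, ?_⟩, ?_⟩
    · rw [div_lt_iff_of_neg hy, div_mul_eq_mul_div, div_lt_iff_of_neg (by linarith)]
      linarith
    · have : y - 1 ≠ 0 := hy.ne
      rw [show y / (y - 1) - 1 = 1 / (y - 1) by field_simp; ring]
      field_simp

/-- Fractional integral transformation of type `a+`. -/
theorem stmt_4 (a b c μ : ℂ) (hca : μ.re < (c - a).re) (hμ : 0 < μ.re)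
    (hc1 : ∀ n : ℕ, c ≠ -(n : ℂ))
    (x : ℝ) (hx : x < 0 ∨ (0 < x ∧ x < 1)) :
    ∫ y in uIoo 0 x,
        ((|y| : ℝ) : ℂ) ^ (c - a - μ - 1) * ((1 - y : ℝ) : ℂ) ^ (a + b - c) * hypF a b c y *
          (((|x - y| : ℝ) : ℂ) ^ (μ - 1) / Complex.Gamma μ)
      = Complex.Gamma (c - a - μ) / Complex.Gamma (c - a) * ((|x| : ℝ) : ℂ) ^ (c - a - 1) *
        ((1 - x : ℝ) : ℂ) ^ (a + b - c + μ) * hypF (a + μ) b c x := by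
  rcases hx with hx | ⟨hx0, hx1⟩
  · have hx1 : x - 1 < 0 := by linarith
    set w : ℝ := x / (x - 1) with hwdef
    have hw0 : 0 < w := div_pos_of_neg_of_neg hx hx1
    have hw1 : w < 1 := by
      rw [hwdef, div_lt_one_of_neg hx1]; linarith
    have h1w : 1 - w = (1 - x)⁻¹ := by
      rw [hwdef]
      have h1 : x - 1 ≠ 0 := hx1.ne
      have h2 : 1 - x ≠ 0 := by linarith
      field_simp
      ring
    have hxw : -x = w / (1 - w) := by
      rw [h1w, hwdef]
      have h1 : x - 1 ≠ 0 := hx1.ne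
      have h2 : 1 - x ≠ 0 := by linarith
      field_simp
      ring
    have hlx : Real.log (1 - x) = - Real.log (1 - w) := by
      rw [h1w, Real.log_inv, neg_neg]
    have hlx' : Real.log (-x) = Real.log w - Real.log (1 - w) := by
      rw [hxw, Real.log_div hw0.ne' (by linarith)]
    rw [uIoo_of_ge hx.le, ← image_mobius hx,
      integral_image_eq_integral_abs_deriv_smul (f' := fun z => -1 / (z - 1) ^ 2)
        measurableSet_Ioo]
    · have hcore := core_integral (c - a) b hca hμ hc1 hw0 hw1
      have hint : ∀ z ∈ Ioo 0 w, |(-1 : ℝ) / (z - 1) ^ 2| •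
          (((|z / (z - 1)| : ℝ) : ℂ) ^ (c - a - μ - 1) *
            ((1 - z / (z - 1) : ℝ) : ℂ) ^ (a + b - c) * hypF a b c (z / (z - 1)) *
            (((|x - z / (z - 1)| : ℝ) : ℂ) ^ (μ - 1) / Complex.Gamma μ)) =
          ((1 - w : ℝ) : ℂ) ^ (1 - μ) *
          ((z : ℂ) ^ (c - a - μ - 1) * (∑' k, hcoef (c - a) b c k * (z : ℂ) ^ k) *
          (((w - z : ℝ) : ℂ) ^ (μ - 1) / Gamma μ)) := by
        rintro z ⟨hz0, hz1⟩
        have hz1' : z < 1 := by linarith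
        have p1 : 0 < 1 - z := by linarith
        have p2 : 0 < 1 - w := by linarith
        have p3 : 0 < w - z := by linarith
        have n1 : 1 - z ≠ 0 := p1.ne'
        have n1' : z - 1 ≠ 0 := by linarith
        have n2 : 1 - w ≠ 0 := p2.ne'
        have hneg : z / (z - 1) < 0 := div_neg_of_pos_of_neg hz0 (by linarith)
        have e1 : |z / (z - 1)| = z / (1 - z) := by
          rw [abs_of_neg hneg, ← neg_sub 1 z, div_neg, neg_neg]
        have e2 : 1 - z / (z - 1) = (1 - z)⁻¹ := by
          field_simp
          ring
        have e3 : |x - z / (z - 1)| = (w - z) / ((1 - w) * (1 - z)) := by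
          have : x - z / (z - 1) = - ((w - z) / ((1 - w) * (1 - z))) := by
            rw [show x = -(w / (1 - w)) by linarith]
            field_simp
            ring
          rw [this, abs_neg, abs_of_pos (by positivity)]
        have e4 : |(-1 : ℝ) / (z - 1) ^ 2| = (1 - z) ^ (-2 : ℤ) := by
          rw [neg_div, abs_neg, abs_of_pos (by positivity), ← neg_sub 1 z, neg_sq, zpow_neg,
            one_div]
          norm_cast
        have e5 : z / (z - 1) / (z / (z - 1) - 1) = z := by
          rw [show z / (z - 1) - 1 = 1 / (z - 1) by field_simp; ring]
          field_simp
        have e6 : (((1 - z) ^ (-2 : ℤ) : ℝ) : ℂ) = exp (-2 * (Real.log (1 - z) : ℂ)) := by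
          rw [← cpow_pos_eq p1]
          push_cast
          rw [← cpow_intCast]
          norm_num
        rw [hypF_of_neg a b c hneg, e5, euler_transf a (c - b) hc1 hz0.le hz1', e1, e2, e3, e4,
          real_smul, e6, show c - (c - b) = b by ring, show c - a - (c - b) = b - a by ring]
        rw [cpow_pos_eq (by positivity), cpow_pos_eq (by positivity), cpow_pos_eq (by positivity),
          cpow_pos_eq (by positivity), cpow_pos_eq (by positivity), cpow_pos_eq (by positivity),
          cpow_pos_eq (by positivity), cpow_pos_eq (by positivity),
          Real.log_div hz0.ne' n1, Real.log_inv, Real.log_div p3.ne' (by positivity),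
          Real.log_mul n2 n1]
        push_cast
        generalize (∑' k, hcoef (c - a) b c k * (z : ℂ) ^ k) = S
        generalize (Real.log z : ℂ) = l1
        generalize (Real.log (1 - z) : ℂ) = l2
        generalize (Real.log (w - z) : ℂ) = l3
        generalize (Real.log (1 - w) : ℂ) = l4
        have : exp (-2 * l2) * exp ((c - a - μ - 1) * (l1 - l2)) * exp ((a + b - c) * -l2) *
            exp (-a * -l2) * exp ((b - a) * l2) * exp ((μ - 1) * (l3 - (l4 + l2)))
            = exp ((1 - μ) * l4) * exp ((c - a - μ - 1) * l1) * exp ((μ - 1) * l3) := by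
          simp only [← exp_add]
          congr 1
          ring
        linear_combination (S / Gamma μ) * this
      rw [setIntegral_congr_fun measurableSet_Ioo hint, integral_const_mul, hcore,
        hypF_of_neg _ _ _ hx, ← hwdef, euler_transf (a + μ) (c - b) hc1 hw0.le hw1,
        show c - (c - b) = b by ring, show c - (a + μ) = c - a - μ by ring,
        abs_of_neg hx]
      have p2 : 0 < 1 - w := by linarith
      have p4 : 0 < 1 - x := by linarith
      have p5 : 0 < -x := by linarith
      rw [cpow_pos_eq p2, cpow_pos_eq p2, cpow_pos_eq p4, cpow_pos_eq p4, cpow_pos_eq p5,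
        cpow_pos_eq hw0, hlx, hlx']
      push_cast
      generalize (∑' k, hcoef (c - a - μ) b c k * (w : ℂ) ^ k) = S
      generalize (Real.log w : ℂ) = l3
      generalize (Real.log (1 - w) : ℂ) = l4
      have : exp ((1 - μ) * l4) * exp ((c - a - 1) * l3) =
          exp ((c - a - 1) * (l3 - l4)) * exp ((a + b - c + μ) * -l4) *
          exp (-(a + μ) * -l4) * exp ((c - a - μ - (c - b)) * l4) := by
        simp only [← exp_add]
        congr 1
        ring
      linear_combination (S * Gamma (c - a - μ) / Gamma (c - a)) * this
    · rintro z ⟨hz0, hz1⟩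
      have n1' : z - 1 ≠ 0 := by linarith
      have := (hasDerivAt_id' z).fun_div ((hasDerivAt_id' z).sub_const 1) n1'
      rw [show 1 * (z - 1) - z * 1 = -1 by ring] at this
      exact this.hasDerivWithinAt
    · rintro z ⟨hz0, hz1⟩ z' ⟨hz0', hz1'⟩ h
      have n1 : z - 1 ≠ 0 := by linarith
      have n2 : z' - 1 ≠ 0 := by linarith
      change z / (z - 1) = z' / (z' - 1) at h
      rw [div_eq_div_iff n1 n2] at h
      linarith
  · have hcore := core_integral (c - a) (c - b) hca hμ hc1 hx0 hx1
    have p2 : 0 < 1 - x := by linarith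
    rw [uIoo_of_le hx0.le, abs_of_pos hx0, hypF_of_nonneg _ _ _ hx0.le,
      euler_transf (a + μ) b hc1 hx0.le hx1, show c - (a + μ) = c - a - μ by ring]
    have hint : ∀ y ∈ Ioo 0 x, ((|y| : ℝ) : ℂ) ^ (c - a - μ - 1) *
          ((1 - y : ℝ) : ℂ) ^ (a + b - c) * hypF a b c y *
          (((|x - y| : ℝ) : ℂ) ^ (μ - 1) / Complex.Gamma μ)
        = (y : ℂ) ^ (c - a - μ - 1) * (∑' k, hcoef (c - a) (c - b) c k * (y : ℂ) ^ k) *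
          (((x - y : ℝ) : ℂ) ^ (μ - 1) / Gamma μ) := by
      rintro y ⟨hy0, hy1⟩
      have p1 : ((1 - y : ℝ) : ℂ) ≠ 0 := ofReal_ne_zero.2 (by linarith)
      rw [abs_of_pos hy0, abs_of_pos (sub_pos.2 hy1), hypF_of_nonneg _ _ _ hy0.le,
        euler_transf a b hc1 hy0.le (by linarith)]
      have : ((1 - y : ℝ) : ℂ) ^ (a + b - c) * ((1 - y : ℝ) : ℂ) ^ (c - a - b) = 1 := by
        rw [← cpow_add _ _ p1, show a + b - c + (c - a - b) = 0 by ring, cpow_zero]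
      linear_combination ((y : ℂ) ^ (c - a - μ - 1) *
        (∑' k, hcoef (c - a) (c - b) c k * (y : ℂ) ^ k) *
          (((x - y : ℝ) : ℂ) ^ (μ - 1) / Gamma μ)) * this
    rw [setIntegral_congr_fun measurableSet_Ioo hint, hcore]
    have : ((1 - x : ℝ) : ℂ) ^ (a + b - c + μ) * ((1 - x : ℝ) : ℂ) ^ (c - a - μ - b) = 1 := by
      rw [← cpow_add _ _ (ofReal_ne_zero.2 p2.ne'),
        show a + b - c + μ + (c - a - μ - b) = 0 by ring, cpow_zero]
    linear_combination (-(Gamma (c - a - μ) / Gamma (c - a) * (x : ℂ) ^ (c - a - 1) *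
      ∑' k, hcoef (c - a - μ) (c - b) c k * (x : ℂ) ^ k)) * this
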